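/- Let M be a commutative monoid and let Π be a group acting on M by monoid homomorphisms, with the action nontrivial (there exist σ ∈ Π and m ∈ M with σ·m ≠ m). Then there is no Π-respecting monomial order on M; that is, there is no linear order ≤ on M that is a well-order, satisfies a ≤ b ⟹ a·c ≤ b·c for all c ∈ M, and satisfies a ≤ b ⟹ σ·a ≤ σ·b for all σ ∈ Π. -/

import Mathlib

/-- If a group `Π` acts nontrivially on a commutative monoid `M` by monoid
homomorphisms, then there is no `Π`-respecting monomial order on `M`: no linear
order on `M` that is a well-order, respects multiplication, and respects the
`Π`-action. -/
theorem no_group_respecting_monomial_order {M G : Type*} [CommMonoid M] [Group G]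
    [MulDistribMulAction G M] (hnt : ∃ (σ : G) (m : M), σ • m ≠ m)
    (r : LinearOrder M) (hwo : WellFounded r.lt)
    (hmul : ∀ a b c : M, r.le a b → r.le (a * c) (b * c))
    (hact : ∀ (σ : G) (a b : M), r.le a b → r.le (σ • a) (σ • b)) : False := by
  have key : ∀ (m : M) (σ : G), m ≤ σ • m := by
    intro m
    induction m using hwo.induction with
    | _ m ih =>
      intro σ
      by_contra hlt
      have hlt' : σ • m < m := not_le.mp hlt
      have h1 : σ • m ≤ σ • (σ • m) := ih (σ • m) hlt' σ
      have h2 := hact σ⁻¹ _ _ h1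
      rw [inv_smul_smul, inv_smul_smul] at h2
      exact hlt h2
  obtain ⟨σ, m, hne⟩ := hnt
  have h := hact σ _ _ (key m σ⁻¹)
  rw [smul_inv_smul] at h
  exact hne (le_antisymm h (key m σ))
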